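/- Let Y be a finite group and N ⊴ Y a normal subgroup with Y/N abelian, and suppose that every irreducible complex character θ of N extends to its inertia group Y_θ = {y ∈ Y : θ(yny⁻¹) = θ(n) for all n ∈ N}. Then for every subgroup X with N ≤ X ≤ Y (automatically normal in Y), restriction from Y to X is multiplicity free: for every irreducible character χ of Y and every irreducible character ψ of X, the multiplicity ⟨χ|_X, ψ⟩ is at most 1. (Abstract form of Theorem 3.6, first assertion.) -/

import Mathlib

open CategoryTheory

/-- The inertia subgroup `Y_f` of a function `f` on a normal subgroup `N ⊴ Y`:
elements `y ∈ Y` such that `f(y n y⁻¹) = f(n)` for all `n ∈ N`. -/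
def inertia {Y : Type*} [Group Y] (N : Subgroup Y) (hN : N.Normal) (f : ↥N → ℂ) :
    Subgroup Y where
  carrier := {y : Y | ∀ (x : Y) (hx : x ∈ N) (hx' : y * x * y⁻¹ ∈ N),
      f ⟨y * x * y⁻¹, hx'⟩ = f ⟨x, hx⟩}
  one_mem' := by
    intro x hx hx'
    have h : (⟨1 * x * 1⁻¹, hx'⟩ : ↥N) = ⟨x, hx⟩ := Subtype.ext (by group)
    rw [h]
  mul_mem' := by
    intro a b ha hb x hx hx'
    have h1 : b * x * b⁻¹ ∈ N := hN.conj_mem x hx b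
    have h2 : a * (b * x * b⁻¹) * a⁻¹ ∈ N := hN.conj_mem _ h1 a
    have h : (⟨a * b * x * (a * b)⁻¹, hx'⟩ : ↥N) = ⟨a * (b * x * b⁻¹) * a⁻¹, h2⟩ :=
      Subtype.ext (by group)
    rw [h, ha _ h1 h2, hb x hx h1]
  inv_mem' := by
    intro a ha x hx hx'
    have h1 : a * (a⁻¹ * x * a⁻¹⁻¹) * a⁻¹ ∈ N := hN.conj_mem _ hx' a
    have key := ha _ hx' h1
    have h : (⟨a * (a⁻¹ * x * a⁻¹⁻¹) * a⁻¹, h1⟩ : ↥N) = ⟨x, hx⟩ := Subtype.ext (by group)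
    rw [h] at key
    exact key.symm

namespace Representation

section Irreducible

variable {k G V : Type*} [Field k] [AddCommGroup V] [Module k V]

theorem isIrreducible_of_forall [Monoid G] [Nontrivial V] (ρ : Representation k G V)
    (h : ∀ S : Subrepresentation ρ, S.toSubmodule = ⊥ ∨ S.toSubmodule = ⊤) :
    IsIrreducible ρ where
  exists_pair_ne := ⟨⊥, ⊤, fun h ↦ bot_ne_top (congrArg Subrepresentation.toSubmodule h)⟩
  eq_bot_or_eq_top S := (h S).imp (Subrepresentation.toSubmodule_injective ·)
    (Subrepresentation.toSubmodule_injective ·)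

theorem IsIrreducible.nontrivial [Monoid G] (ρ : Representation k G V) [IsIrreducible ρ] :
    Nontrivial V := by
  by_contra h
  rw [not_nontrivial_iff_subsingleton] at h
  exact bot_ne_top (α := Subrepresentation ρ)
    (Subrepresentation.toSubmodule_injective (Subsingleton.elim _ _))

theorem IsIrreducible.eq_bot_or_eq_top_of_invariant [Monoid G] (ρ : Representation k G V)
    [IsIrreducible ρ] (S : Submodule k V) (h : ∀ g, ∀ v ∈ S, ρ g v ∈ S) : S = ⊥ ∨ S = ⊤ :=
  (IsSimpleOrder.eq_bot_or_eq_top (⟨S, fun g _ hv ↦ h g _ hv⟩ : Subrepresentation ρ)).imp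
    (congrArg Subrepresentation.toSubmodule ·) (congrArg Subrepresentation.toSubmodule ·)

theorem exists_isIrreducible_toRepresentation [Monoid G] [FiniteDimensional k V] [Nontrivial V]
    (ρ : Representation k G V) :
    ∃ S : Subrepresentation ρ, IsIrreducible S.toRepresentation := by
  obtain ⟨S, hS, hmin⟩ := exists_minimalFor_of_wellFoundedLT
    (fun S : Subrepresentation ρ ↦ S.toSubmodule ≠ ⊥) (fun S ↦ Module.finrank k S.toSubmodule)
    ⟨⊤, top_ne_bot (α := Submodule k V)⟩
  have : Nontrivial S.toSubmodule := S.toSubmodule.nontrivial_iff_ne_bot.mpr hS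
  refine ⟨S, isIrreducible_of_forall _ fun R ↦ or_iff_not_imp_left.mpr fun hR ↦ ?_⟩
  let R' : Subrepresentation ρ := ⟨R.toSubmodule.map S.toSubmodule.subtype, by
    rintro g _ ⟨v, hv, rfl⟩
    exact ⟨_, R.apply_mem_toSubmodule g hv, rfl⟩⟩
  have hf : Module.finrank k R'.toSubmodule = Module.finrank k R.toSubmodule :=
    Submodule.finrank_map_subtype_eq _ _
  have hR' : R'.toSubmodule ≠ ⊥ := by
    exact fun h ↦ hR (Submodule.map_injective_of_injective S.toSubmodule.injective_subtype
      (h.trans (Submodule.map_bot _).symm))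
  have := hmin hR' (hf.trans_le (Submodule.finrank_le _))
  exact Submodule.eq_top_of_finrank_eq (le_antisymm (Submodule.finrank_le _) (hf ▸ this))

variable [Group G] [Finite G] [NeZero (Nat.card G : k)]

theorem isIrreducible_of_finrank_intertwiningMap_self [FiniteDimensional k V]
    {ρ : Representation k G V}
    (h : Module.finrank k (IntertwiningMap ρ ρ) = 1) : IsIrreducible ρ := by
  have hV : Nontrivial V := by
    by_contra hV
    rw [not_nontrivial_iff_subsingleton] at hV
    have : Subsingleton (IntertwiningMap ρ ρ) := ⟨fun f g ↦ by ext v; exact Subsingleton.elim _ _⟩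
    rw [Module.finrank_zero_of_subsingleton] at h
    exact zero_ne_one h
  refine isIrreducible_of_forall _ fun S ↦ ?_
  obtain ⟨R, hR⟩ := exists_isCompl S
  have hc : IsCompl S.toSubmodule R.toSubmodule :=
    IsCompl.of_eq (congrArg Subrepresentation.toSubmodule hR.inf_eq_bot)
      (congrArg Subrepresentation.toSubmodule hR.sup_eq_top)
  let p : V →ₗ[k] V := S.toSubmodule.projection R.toSubmodule hc
  have hpS (v : V) : p v ∈ S.toSubmodule := Submodule.projection_apply_mem hc v
  have hpv (v) (hv : v ∈ S.toSubmodule) : p v = v :=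
    S.toSubmodule.projection_apply_of_mem_left hc hv
  have hpr (v) (hv : v ∈ R.toSubmodule) : p v = 0 :=
    S.toSubmodule.projection_apply_of_mem_right hc hv
  have hp (g : G) (v : V) : p (ρ g v) = ρ g (p v) := by
    obtain ⟨s, hs, r, hr, rfl⟩ := Submodule.mem_sup.mp
      (hc.sup_eq_top ▸ Submodule.mem_top : v ∈ S.toSubmodule ⊔ R.toSubmodule)
    simp [hpv _ hs, hpr _ hr, hpv _ (S.apply_mem_toSubmodule g hs),
      hpr _ (R.apply_mem_toSubmodule g hr)]
  let P : IntertwiningMap ρ ρ := p.intertwiningMap_of_isIntertwiningMap _ _ hp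
  have h1 : IntertwiningMap.id ρ ≠ 0 := by
    obtain ⟨v, hv⟩ := exists_ne (0 : V)
    exact fun h ↦ hv congr($h v)
  obtain ⟨c, hc'⟩ := (finrank_eq_one_iff_of_nonzero' _ h1).mp h P
  have hpc (v : V) : p v = c • v := congr($hc' v).symm
  by_cases hc0 : c = 0
  · left
    refine (Submodule.eq_bot_iff _).mpr fun v hv ↦ ?_
    rw [← hpv v hv, hpc, hc0, zero_smul]
  · right
    refine eq_top_iff.mpr fun v _ ↦ ?_
    have := S.toSubmodule.smul_mem c⁻¹ (hpS v)
    rwa [hpc, inv_smul_smul₀ hc0] at this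

end Irreducible

section Character

variable {k G V W : Type*} [Field k] [IsAlgClosed k] [CharZero k] [AddCommGroup V] [Module k V]
  [FiniteDimensional k V] [AddCommGroup W] [Module k W] [FiniteDimensional k W]
  [Group G] [Fintype G]

omit [IsAlgClosed k] in
theorem sum_char_mul_char_inv_eq (ρ : Representation k G V) (σ : Representation k G W) :
    (Nat.card G : k)⁻¹ * ∑ g : G, σ.character g * ρ.character g⁻¹ =
      Module.finrank k (IntertwiningMap ρ σ) := by
  have := invertibleOfNonzero (NeZero.ne (Nat.card G : k))
  exact card_inv_mul_sum_char_mul_char_eq_finrank ρ σ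

theorem isIrreducible_iff_char (ρ : Representation k G V) :
    IsIrreducible ρ ↔ ∑ g : G, ρ.character g * ρ.character g⁻¹ = Nat.card G := by
  have h := sum_char_mul_char_inv_eq ρ ρ
  have h0 : (Nat.card G : k) ≠ 0 := NeZero.ne _
  rw [inv_mul_eq_iff_eq_mul₀ h0] at h
  rw [h, mul_eq_left₀ h0, Nat.cast_eq_one]
  exact ⟨fun _ ↦ IsIrreducible.finrank_intertwiningMap_self ρ,
    isIrreducible_of_finrank_intertwiningMap_self⟩

/-- An irreducible representation stays irreducible after twisting by an automorphism. -/
theorem IsIrreducible.comp_mulEquiv (ρ : Representation k G V) [IsIrreducible ρ] (φ : G ≃* G) :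
    IsIrreducible (MonoidHom.comp ρ φ.toMonoidHom : Representation k G V) := by
  rw [isIrreducible_iff_char]
  rw [← (isIrreducible_iff_char ρ).mp ‹_›,
    ← φ.toEquiv.sum_comp fun g ↦ ρ.character g * ρ.character g⁻¹]
  simp [character]

open scoped Classical in
/-- The central element attached to the character of `θ` acts on an irreducible representation
as a scalar. -/
theorem exists_sum_char_inv_smul_eq_smul (θ : Representation k G W) (σ : Representation k G V)
    [IsIrreducible θ] [IsIrreducible σ] :
    ∃ c : k, (∑ g : G, θ.character g⁻¹ • σ g = c • LinearMap.id) ∧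
      (c ≠ 0 ↔ Nonempty (Equiv θ σ)) := by
  have h0 : (Nat.card G : k) ≠ 0 := NeZero.ne _
  have := invertibleOfNonzero h0
  let e : V →ₗ[k] V := ∑ g : G, θ.character g⁻¹ • σ g
  have he (h : G) (v : V) : e (σ h v) = σ h (e v) := by
    simp only [e, LinearMap.sum_apply, LinearMap.smul_apply, _root_.map_sum, map_smul]
    rw [← (MulAut.conj h).toEquiv.sum_comp]
    refine Finset.sum_congr rfl fun g _ ↦ ?_
    have : (h * g * h⁻¹)⁻¹ = h * g⁻¹ * h⁻¹ := by group
    simp [this, ← Module.End.mul_apply, ← map_mul]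
  obtain ⟨c, hc⟩ := (IsIrreducible.algebraMap_intertwiningMap_bijective_of_isAlgClosed
    (ρ := σ)).surjective (e.intertwiningMap_of_isIntertwiningMap _ _ he)
  have hc' : e = c • LinearMap.id := by
    ext v; exact congr($hc v).symm
  refine ⟨c, hc', ?_⟩
  have ht := congrArg (LinearMap.trace k V) hc'
  have ho := char_orthonormal σ θ
  simp only [e, _root_.map_sum, map_smul, LinearMap.trace_id, smul_eq_mul] at ht
  simp_rw [mul_comm (σ.character _)] at ho
  simp only [character] at ho ht
  rw [ht] at ho
  have := IsIrreducible.nontrivial σ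
  have hd : (Module.finrank k V : k) ≠ 0 := Nat.cast_ne_zero.mpr Module.finrank_pos.ne'
  split_ifs at ho with hiso
  · simp only [hiso, iff_true]
    rintro rfl
    simp at ho
  · simp only [hiso, iff_false, not_not]
    simpa [h0, hd] using ho

end Character

section Clifford

theorem exists_mem_invariants_forall_exists_smul {k G V : Type*} [Field k] [IsAlgClosed k]
    [AddCommGroup V] [Module k V] [FiniteDimensional k V] [Group G] (S : Subgroup G) [S.Normal]
    (hS : ∀ a b : G, a * b * a⁻¹ * b⁻¹ ∈ S) (π : Representation k G V)
    [Nontrivial (invariants (MonoidHom.comp π S.subtype))] :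
    ∃ v ∈ invariants (MonoidHom.comp π S.subtype), v ≠ 0 ∧ ∀ g, ∃ c : k, π g v = c • v := by
  have : IsMulCommutative (G ⧸ S) := ⟨⟨fun a b ↦ by
    induction a using QuotientGroup.induction_on with | H a => ?_
    induction b using QuotientGroup.induction_on with | H b => ?_
    rw [← QuotientGroup.mk_mul, ← QuotientGroup.mk_mul, QuotientGroup.eq]
    simpa [mul_assoc] using hS b⁻¹ a⁻¹⟩⟩
  obtain ⟨R, hR⟩ := exists_isIrreducible_toRepresentation (π.quotientToInvariants S)
  obtain ⟨⟨⟨v, hv⟩, hvR⟩, hv0, hspan⟩ := finrank_eq_one_iff'.mp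
    (IsIrreducible.finrank_eq_one_of_isMulCommutative R.toRepresentation)
  refine ⟨v, hv, fun h ↦ hv0 (by ext; exact h), fun g ↦ ?_⟩
  obtain ⟨c, hc⟩ := hspan (R.toRepresentation (g : G ⧸ S) ⟨⟨v, hv⟩, hvR⟩)
  exact ⟨c, congr(($hc).1.1).symm⟩

variable {k Y E W : Type*} [Field k] [IsAlgClosed k] [CharZero k] [Group Y] [Finite Y]
  [AddCommGroup E] [Module k E] [FiniteDimensional k E]
  [AddCommGroup W] [Module k W] [FiniteDimensional k W]

/-- If an irreducible representation of a normal subgroup `N` with abelian quotient extends to a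
representation `τ` of its inertia group `T`, then it occurs at most once in the restriction to `N`
of an irreducible representation. -/
theorem finrank_intertwiningMap_le_one_of_extension {N T : Subgroup Y} [N.Normal] (hNT : N ≤ T)
    (hab : ∀ a b : Y, a * b * a⁻¹ * b⁻¹ ∈ N) (τ : Representation k T E)
    [hirr : IsIrreducible (MonoidHom.comp τ (Subgroup.inclusion hNT) : Representation k N E)]
    (hT : ∀ y ∉ T, ∃ n : N, τ.character (Subgroup.inclusion hNT (MulAut.conjNormal y n)) ≠
      τ.character (Subgroup.inclusion hNT n))
    (ρ : Representation k Y W) [IsIrreducible ρ] :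
    Module.finrank k (IntertwiningMap
      (MonoidHom.comp τ (Subgroup.inclusion hNT) : Representation k N E)
      (MonoidHom.comp ρ N.subtype : Representation k N W)) ≤ 1 := by
  have := Fintype.ofFinite N
  set θ : Representation k N E := MonoidHom.comp τ (Subgroup.inclusion hNT)
  set σ : Representation k N W := MonoidHom.comp ρ N.subtype
  rcases subsingleton_or_nontrivial (IntertwiningMap θ σ) with hM | hM
  · rw [Module.finrank_zero_of_subsingleton]; exact zero_le_one
  let π := linHom τ (MonoidHom.comp ρ T.subtype : Representation k T W)
  have hinv (f : E →ₗ[k] W) : f ∈ invariants (MonoidHom.comp π (N.subgroupOf T).subtype) ↔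
      ∀ n v, f (θ n v) = σ n (f v) := by
    refine ⟨fun h n v ↦ ?_, fun h n ↦ ?_⟩
    · have := congr($(h ⟨Subgroup.inclusion hNT n, n.2⟩) (θ n v))
      change ρ n (f (τ (Subgroup.inclusion hNT n)⁻¹ (τ (Subgroup.inclusion hNT n) v))) = _ at this
      rw [τ.inv_self_apply] at this
      exact this.symm
    · ext v
      have := h ⟨n, n.2⟩ (τ (n : T)⁻¹ v)
      change f (τ (n : T) (τ (n : T)⁻¹ v)) = _ at this
      rw [τ.self_inv_apply] at this
      exact this.symm
  have : Nontrivial (invariants (MonoidHom.comp π (N.subgroupOf T).subtype)) := by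
    obtain ⟨f, hf⟩ := exists_ne (0 : IntertwiningMap θ σ)
    refine ⟨⟨⟨f.toLinearMap, (hinv _).mpr f.isIntertwining⟩, 0, fun h ↦ hf ?_⟩⟩
    ext v
    exact congr(($h).1 v)
  obtain ⟨f, hfinv, hf0, hf⟩ := exists_mem_invariants_forall_exists_smul (N.subgroupOf T)
    (fun a b ↦ hab a b) π
  rw [hinv] at hfinv
  have hfT (t : T) : ∃ c : k, ∀ v, ρ t (f v) = c • f (τ t v) := by
    obtain ⟨c, hc⟩ := hf t
    refine ⟨c, fun v ↦ ?_⟩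
    simpa [π] using congr($hc (τ t v))
  let F : IntertwiningMap θ σ := f.intertwiningMap_of_isIntertwiningMap _ _ hfinv
  have hfinj : Function.Injective f := (IsIrreducible.injective_or_eq_zero F).resolve_right
    fun h ↦ hf0 (by ext v; exact congr($h v))
  let e : W →ₗ[k] W := ∑ n : N, θ.character n⁻¹ • σ n
  have heθ (g : IntertwiningMap θ σ) (v : E) :
      e (g v) = g ((∑ n : N, θ.character n⁻¹ • θ n) v) := by
    simp [e, LinearMap.sum_apply, g.isIntertwining]
  obtain ⟨c, hc, hc0⟩ := exists_sum_char_inv_smul_eq_smul θ θ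
  have heθ' (g : IntertwiningMap θ σ) (v : E) : e (g v) = c • g v := by
    rw [heθ, hc]; simp
  have hc0 : c ≠ 0 := hc0.mpr ⟨.refl θ⟩
  have hef (y : Y) (v : E) : e (ρ y (f v)) ∈ LinearMap.range f := by
    by_cases hy : y ∈ T
    · obtain ⟨a, ha⟩ := hfT ⟨y, hy⟩
      have := heθ' F (τ ⟨y, hy⟩ v)
      change e (f _) = c • f _ at this
      replace ha : ρ y (f v) = _ := ha v
      rw [ha, map_smul, this]
      exact Submodule.smul_mem _ _ (Submodule.smul_mem _ _ ⟨_, rfl⟩)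
    · let φ : N ≃* N := MulAut.conjNormal y⁻¹
      let θ' : Representation k N E := MonoidHom.comp θ φ.toMonoidHom
      have hθ' : IsIrreducible θ' := IsIrreducible.comp_mulEquiv θ φ
      obtain ⟨d, hd, hd0⟩ := exists_sum_char_inv_smul_eq_smul θ θ'
      have hd0 : d = 0 := by
        by_contra h
        obtain ⟨i⟩ := hd0.mp h
        obtain ⟨n, hn⟩ := hT y hy
        apply hn
        have := congrFun (char_iso i) (MulAut.conjNormal y n)
        have h2 : φ (MulAut.conjNormal y n) = n := by
          ext; simp [φ]
        change _ = θ.character (φ (MulAut.conjNormal y n)) at this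
        rwa [h2] at this
      have hyn (n : N) : σ n (ρ y (f v)) = ρ y (f (θ' n v)) := by
        have : f (θ' n v) = σ (φ n) (f v) := hfinv _ _
        rw [this]
        simp [σ, φ, ← Module.End.mul_apply, ← map_mul, mul_assoc]
      have : e (ρ y (f v)) = ρ y (f ((∑ n : N, θ.character n⁻¹ • θ' n) v)) := by
        simp [e, LinearMap.sum_apply, hyn]
      rw [this, hd, hd0]
      simp
  have hspan : Submodule.span k (Set.range fun p : Y × E ↦ ρ p.1 (f p.2)) = ⊤ := by
    refine (IsIrreducible.eq_bot_or_eq_top_of_invariant ρ _ fun g w hw ↦ ?_).resolve_left ?_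
    · induction hw using Submodule.span_induction with
      | mem w hw =>
        obtain ⟨⟨y, v⟩, rfl⟩ := hw
        exact Submodule.subset_span ⟨(g * y, v), by simp⟩
      | zero => simp
      | add a b _ _ ha hb => rw [map_add]; exact add_mem ha hb
      | smul a w _ hw => rw [map_smul]; exact Submodule.smul_mem _ _ hw
    · intro h
      apply hf0
      ext v
      have : f v ∈ Submodule.span k (Set.range fun p : Y × E ↦ ρ p.1 (f p.2)) :=
        Submodule.subset_span ⟨(1, v), by simp⟩
      rw [h] at this
      exact this
  have hrange (w : W) : e w ∈ LinearMap.range f := by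
    have hw : w ∈ Submodule.span k (Set.range fun p : Y × E ↦ ρ p.1 (f p.2)) :=
      hspan ▸ Submodule.mem_top
    rw [← Submodule.mem_comap]
    refine Submodule.span_le.mpr ?_ hw
    rintro _ ⟨⟨y, v⟩, rfl⟩
    exact hef y v
  refine finrank_le_one F fun g ↦ ?_
  have hg (v : E) : ∃ u, f u = g v := by
    have := Submodule.smul_mem _ c⁻¹ (hrange (g v))
    rwa [heθ', inv_smul_smul₀ hc0] at this
  let h : E →ₗ[k] E := (LinearEquiv.ofInjective f hfinj).symm.toLinearMap ∘ₗ
    g.toLinearMap.codRestrict (LinearMap.range f) hg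
  have hh (v : E) : f (h v) = g v :=
    congrArg Subtype.val ((LinearEquiv.ofInjective f hfinj).apply_symm_apply ⟨g v, hg v⟩)
  have hhθ (n : N) (v : E) : h (θ n v) = θ n (h v) := by
    apply hfinj
    rw [hh, hfinv, hh, g.isIntertwining]
  obtain ⟨a, ha⟩ := (IsIrreducible.algebraMap_intertwiningMap_bijective_of_isAlgClosed
    (ρ := θ)).surjective (h.intertwiningMap_of_isIntertwiningMap _ _ hhθ)
  refine ⟨a, ?_⟩
  ext v
  have hav : a • v = h v := congr($ha v)
  change a • f v = g v
  rw [← hh, ← hav, map_smul]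

/-- Multiplicity one for restriction to a subgroup `N` implies multiplicity one for restriction to
any intermediate subgroup. -/
theorem finrank_intertwiningMap_le_one_of_le {G V : Type*} {k : Type*} {W : Type*} [Field k]
    [Group G] [AddCommGroup V] [Module k V] [FiniteDimensional k V] [AddCommGroup W] [Module k W]
    [FiniteDimensional k W]
    {N X : Subgroup G} (hNX : N ≤ X) (ρ : Representation k G W)
    (σ : Representation k X V) [IsIrreducible σ]
    (h : ∀ S : Subrepresentation (MonoidHom.comp σ (Subgroup.inclusion hNX)),
      IsIrreducible S.toRepresentation →
        Module.finrank k (IntertwiningMap S.toRepresentation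
          (MonoidHom.comp ρ N.subtype : Representation k N W)) ≤ 1) :
    Module.finrank k (IntertwiningMap σ (MonoidHom.comp ρ X.subtype : Representation k X W))
      ≤ 1 := by
  have := IsIrreducible.nontrivial σ
  obtain ⟨S, hS⟩ := exists_isIrreducible_toRepresentation
    (MonoidHom.comp σ (Subgroup.inclusion hNX) : Representation k N V)
  have := IsIrreducible.nontrivial S.toRepresentation
  let r : IntertwiningMap σ (MonoidHom.comp ρ X.subtype : Representation k X W) →ₗ[k]
      IntertwiningMap S.toRepresentation (MonoidHom.comp ρ N.subtype : Representation k N W) :=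
    { toFun f := (f.toLinearMap ∘ₗ S.toSubmodule.subtype).intertwiningMap_of_isIntertwiningMap _ _
        fun n v ↦ f.isIntertwining _ _ (Subgroup.inclusion hNX n) v
      map_add' _ _ := rfl
      map_smul' _ _ := rfl }
  refine (LinearMap.finrank_le_finrank_of_injective (f := r) ?_).trans (h S hS)
  refine (injective_iff_map_eq_zero r).mpr fun f hf ↦ ?_
  refine (IsIrreducible.injective_or_eq_zero f).resolve_left fun hinj ↦ ?_
  obtain ⟨v, hv⟩ := exists_ne (0 : S.toSubmodule)
  refine hv (Subtype.ext (hinj ?_))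
  rw [ZeroMemClass.coe_zero, map_zero]
  exact congr($hf v)

end Clifford

/-- The values of a complex character at inverse elements are complex conjugate. -/
theorem conj_character {G V : Type*} [Group G] [Finite G] [AddCommGroup V] [Module ℂ V]
    [FiniteDimensional ℂ V] (ρ : Representation ℂ G V) (g : G) :
    (starRingEnd ℂ) (ρ.character g) = ρ.character g⁻¹ := by
  classical
  open scoped ComplexOrder Matrix in
  have := Fintype.ofFinite G
  let b := Module.finBasis ℂ V
  let A (g : G) := LinearMap.toMatrix b b (ρ g)
  have hA (g h : G) : A (g * h) = A g * A h := by simp [A, LinearMap.toMatrix_mul]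
  have hA1 : A 1 = 1 := by simp [A]
  have htr (g : G) : ρ.character g = (A g).trace := LinearMap.trace_eq_matrix_trace ℂ b _
  let H := ∑ h : G, (A h)ᴴ * A h
  have hH : H.PosDef := Matrix.posDef_sum Finset.univ_nonempty fun h _ ↦ by
    refine Matrix.PosDef.conjTranspose_mul_self _ (Matrix.mulVec_injective_of_isUnit ?_)
    exact IsUnit.of_mul_eq_one (A h⁻¹) (by rw [← hA, mul_inv_cancel, hA1])
  have hinv : (A g)ᴴ * H * A g = H := by
    simp only [H, Finset.mul_sum, Finset.sum_mul]
    rw [← Equiv.sum_comp (Equiv.mulRight g) fun h ↦ (A h)ᴴ * A h]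
    simp [hA, Matrix.conjTranspose_mul, Matrix.mul_assoc]
  have hu := (Matrix.isUnit_iff_isUnit_det _).mp hH.isUnit
  have hg : (A g)ᴴ = H * A g⁻¹ * H⁻¹ := by
    have hg' : A g * A g⁻¹ = 1 := by rw [← hA, mul_inv_cancel, hA1]
    conv_rhs => enter [1, 1]; rw [← hinv]
    rw [Matrix.mul_assoc _ (A g), hg', Matrix.mul_one, Matrix.mul_assoc,
      Matrix.mul_nonsing_inv _ hu, Matrix.mul_one]
  rw [htr, htr, ← Complex.star_def, ← Matrix.trace_conjTranspose, hg, Matrix.trace_mul_comm,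
    Matrix.nonsing_inv_mul_cancel_left _ _ hu]

end Representation

theorem FDRep.simple_iff_isIrreducible.{u} {k G : Type u} [Field k] [IsAlgClosed k]
    [CharZero k] [Group G] [Finite G] {V : FDRep k G} :
    Simple V ↔ Representation.IsIrreducible V.ρ := by
  have := Fintype.ofFinite G
  rw [FDRep.simple_iff_char_is_norm_one, Representation.isIrreducible_iff_char]
  rfl

/-- abstract form of Theorem 3.6, first assertion: let `Y` be a finite
group, `N ⊴ Y` with `Y/N` abelian (i.e. all commutators lie in `N`), and suppose every
irreducible complex character of `N` extends to its inertia group.  Then for every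
intermediate subgroup `N ≤ X ≤ Y`, restriction from `Y` to `X` is multiplicity free:
the multiplicity `⟨χ|_X, ψ⟩` of any irreducible character `ψ` of `X` in the restriction
of any irreducible character `χ` of `Y` is `0` or `1`. -/
theorem restriction_multiplicity_free (Y : Type) [Group Y] [Fintype Y]
    (N : Subgroup Y) (hN : N.Normal)
    (hab : ∀ a b : Y, a * b * a⁻¹ * b⁻¹ ∈ N)
    (hext : ∀ V : FDRep ℂ ↥N, Simple V →
      ∃ W : FDRep ℂ ↥(inertia N hN V.character),
        ∀ (n : Y) (hn : n ∈ N) (hn' : n ∈ inertia N hN V.character),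
          W.character ⟨n, hn'⟩ = V.character ⟨n, hn⟩) :
    ∀ X : Subgroup Y, N ≤ X →
      ∀ (W : FDRep ℂ Y) (V : FDRep ℂ ↥X), Simple W → Simple V →
        (↑(Nat.card ↥X) : ℂ)⁻¹ *
            ∑ᶠ x : ↥X, W.character ↑x * (starRingEnd ℂ) (V.character x) = 0 ∨
        (↑(Nat.card ↥X) : ℂ)⁻¹ *
            ∑ᶠ x : ↥X, W.character ↑x * (starRingEnd ℂ) (V.character x) = 1 := by
  intro X hNX W V hW hV
  have := Fintype.ofFinite X
  have := Fintype.ofFinite N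
  have hWirr : Representation.IsIrreducible W.ρ := FDRep.simple_iff_isIrreducible.mp hW
  have hVirr : Representation.IsIrreducible V.ρ := FDRep.simple_iff_isIrreducible.mp hV
  let σ : Representation ℂ X W := MonoidHom.comp W.ρ X.subtype
  have hsum : (Nat.card X : ℂ)⁻¹ * ∑ᶠ x : X, W.character x * (starRingEnd ℂ) (V.character x) =
      Module.finrank ℂ (Representation.IntertwiningMap V.ρ σ) := by
    rw [finsum_eq_sum_of_fintype, ← Representation.sum_char_mul_char_inv_eq]
    congr! with x
    exact Representation.conj_character V.ρ x
  have hle : Module.finrank ℂ (Representation.IntertwiningMap V.ρ σ) ≤ 1 := by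
    refine Representation.finrank_intertwiningMap_le_one_of_le hNX W.ρ V.ρ fun S hS ↦ ?_
    let U := FDRep.of S.toRepresentation
    obtain ⟨E, hE⟩ := hext U (FDRep.simple_iff_isIrreducible.mpr hS)
    have hNT : N ≤ inertia N hN U.character := fun n hn x hx hx' ↦
      FDRep.char_conj U ⟨x, hx⟩ ⟨n, hn⟩
    let θ : Representation ℂ N E := MonoidHom.comp E.ρ (Subgroup.inclusion hNT)
    have hchar : θ.character = S.toRepresentation.character :=
      funext fun n ↦ hE n n.2 (hNT n.2)
    have hθ : θ.IsIrreducible := by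
      rw [Representation.isIrreducible_iff_char, hchar, ← Representation.isIrreducible_iff_char]
      exact hS
    have heq := Representation.sum_char_mul_char_inv_eq θ (MonoidHom.comp W.ρ N.subtype)
    rw [hchar, Representation.sum_char_mul_char_inv_eq, Nat.cast_inj] at heq
    rw [heq]
    refine Representation.finrank_intertwiningMap_le_one_of_extension hNT hab E.ρ
      (fun y hy ↦ ?_) W.ρ
    by_contra! h
    refine hy fun x hx hx' ↦ ?_
    have h1 := h ⟨x, hx⟩
    exact (congrFun hchar ⟨_, hx'⟩).symm.trans (h1.trans (congrFun hchar ⟨x, hx⟩))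
  rw [hsum]
  exact_mod_cast Nat.le_one_iff_eq_zero_or_eq_one.mp hle
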